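/- Let t ≥ 2 and let λ ⊢_o 2^t + 1. Then f_0(f_0(λ)) = f_1(λ) if and only if λ or its conjugate λ′ equals (2^t + 1) or (2^t − 1, 2). In particular, G_0(2^t + 1) = 4. -/

import Mathlib

namespace OddSym

open scoped Classical

/-- Remove one box from a row of size `p` (as multisets of parts). -/
def removeBox (lam : Multiset ℕ) (p : ℕ) : Multiset ℕ :=
  if p ≤ 1 then lam.erase p else (p - 1) ::ₘ lam.erase p

lemma removeBox_sum_lt {lam : Multiset ℕ} {p : ℕ} (hp : p ∈ lam) (h0 : 0 < p) :
    (removeBox lam p).sum < lam.sum := by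
  have h : p + (lam.erase p).sum = lam.sum := by
    conv_rhs => rw [← Multiset.cons_erase hp]
    simp [Multiset.sum_cons]
  unfold removeBox
  split
  · omega
  · simp only [Multiset.sum_cons]
    omega

/-- The number of standard Young tableaux of shape `lam`
(equivalently, the degree of the irreducible character of the symmetric
group labelled by `lam`), defined via the branching rule. -/
def degSYT (lam : Multiset ℕ) : ℕ :=
  if _h : lam = 0 then 1
  else ∑ p ∈ (lam.toFinset.filter (fun p => 0 < p)).attach, degSYT (removeBox lam p.1)
termination_by lam.sum
decreasing_by
  have hp := p.2
  simp only [Finset.mem_filter, Multiset.mem_toFinset] at hp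
  exact removeBox_sum_lt hp.1 hp.2

/-- `lam` is an odd partition: all parts positive and the number of standard
Young tableaux of shape `lam` (= the character degree) is odd. -/
def OddP (lam : Multiset ℕ) : Prop :=
  (∀ x ∈ lam, 0 < x) ∧ Odd (degSYT lam)

/-- The parts of `lam` sorted in weakly decreasing order. -/
def descList (lam : Multiset ℕ) : List ℕ :=
  (lam.sort (· ≤ ·)).reverse

/-- The beta-set (set of beta-numbers) of `lam` with `m` beads:
`{ lam_i + (m - i) : 1 ≤ i ≤ m }` where `lam` is padded with zero parts. -/
def betaSet (lam : Multiset ℕ) (m : ℕ) : Finset ℕ :=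
  (Finset.range m).image (fun i => (descList lam).getD i 0 + (m - 1 - i))

/-- `mu` is obtained from `lam` by removing an `e`-hook: in some beta-set of
`lam` a beta-number `x` is replaced by `x - e` (which is not a beta-number). -/
def IsHookRemoval (e : ℕ) (lam mu : Multiset ℕ) : Prop :=
  (∀ x ∈ lam, 0 < x) ∧ (∀ x ∈ mu, 0 < x) ∧ 0 < e ∧
  ∃ m x, Multiset.card lam ≤ m ∧ Multiset.card mu ≤ m ∧
    x ∈ betaSet lam m ∧ e ≤ x ∧ x - e ∉ betaSet lam m ∧
    betaSet mu m = insert (x - e) ((betaSet lam m).erase x)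

/-- The map `f_k` : for an odd partition `lam` with `2^k ≤ |lam|`, the unique
odd partition obtained from `lam` by removing a `2^k`-hook (junk value `0` if
no such partition exists). -/
noncomputable def fkOp (k : ℕ) (lam : Multiset ℕ) : Multiset ℕ :=
  if h : ∃ mu, IsHookRemoval (2 ^ k) lam mu ∧ OddP mu then h.choose else 0

/-- The partition encoded by a finite beta-set: each bead contributes a part
equal to the number of gaps below it. -/
def partOfBeta (S : Finset ℕ) : Multiset ℕ :=
  (S.val.map (fun b => b - (S.filter (fun a => a < b)).card)).filter (fun p => 0 < p)

/-- The 2-quotient `(lam_0, lam_1)` of `lam`, computed from a beta-set with an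
even number of beads via the two runners of the 2-abacus. -/
def quot2 (lam : Multiset ℕ) : Multiset ℕ × Multiset ℕ :=
  (partOfBeta (((betaSet lam (2 * Multiset.card lam)).filter (fun b => b % 2 = 0)).image
      (fun b => b / 2)),
   partOfBeta (((betaSet lam (2 * Multiset.card lam)).filter (fun b => b % 2 = 1)).image
      (fun b => b / 2)))

/-- The `e`-core of `lam`: push all beads of an `e`-abacus configuration for
`lam` up as far as possible. -/
def coreP (e : ℕ) (lam : Multiset ℕ) : Multiset ℕ :=
  partOfBeta ((Finset.range (e * (Multiset.card lam + e))).filter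
    (fun x => x / e <
      ((betaSet lam (Multiset.card lam + e)).filter (fun b => b % e = x % e)).card))

/-- Row `k` of the 2-quotient tower of `lam`: row 0 is `[lam]`, and row `k+1`
replaces each entry of row `k` by its 2-quotient pair. -/
def towerRow : ℕ → Multiset ℕ → List (Multiset ℕ)
  | 0, lam => [lam]
  | (k + 1), lam => (towerRow k lam).flatMap (fun mu => [(quot2 mu).1, (quot2 mu).2])

/-- `R_k^j(lam)`: the component of row `k` of the 2-quotient tower of `lam`
from which a `2^(j-k)`-hook is removed in the passage from `lam` to `f_j(lam)`;
it is characterized by: row `k` for `f_j(lam)` is obtained from row `k` for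
`lam` by replacing this component by its image under `f_(j-k)`. -/
noncomputable def Rcomp (k j : ℕ) (lam : Multiset ℕ) : Multiset ℕ :=
  if h : ∃ s, s < 2 ^ k ∧
      towerRow k (fkOp j lam) =
        (towerRow k lam).set s (fkOp (j - k) ((towerRow k lam).getD s 0))
  then (towerRow k lam).getD h.choose 0 else 0

/-- `G_k(n)`, the number of odd partitions `lam` of `n` with
`f_k(f_k(lam)) = f_(k+1)(lam)`. -/
noncomputable def Gnum (k n : ℕ) : ℕ :=
  {lam : Multiset ℕ | OddP lam ∧ lam.sum = n ∧
    fkOp k (fkOp k lam) = fkOp (k + 1) lam}.ncard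

/-- The conjugate (transpose) partition of `lam`. -/
def conjP (lam : Multiset ℕ) : Multiset ℕ :=
  ((Finset.range lam.sum).val.map
    (fun i => Multiset.card (lam.filter (fun p => i < p)))).filter (fun p => 0 < p)

/-- The number of beads of `T` strictly below position `b`. -/
def below (T : Finset ℕ) (b : ℕ) : ℕ := (T.filter (fun a => a < b)).card

lemma partOfBeta_eq (S : Finset ℕ) :
    partOfBeta S = (S.val.map (fun b => b - below S b)).filter (fun p => 0 < p) := rfl

lemma below_le (T : Finset ℕ) (b : ℕ) : below T b ≤ b := by
  unfold below
  calc _ ≤ (Finset.range b).card := Finset.card_le_card (by intro a; simp)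
    _ = b := Finset.card_range b

lemma below_succ (T : Finset ℕ) (b : ℕ) :
    below T (b + 1) = below T b + if b ∈ T then 1 else 0 := by
  unfold below
  split_ifs with h
  · rw [← Finset.card_insert_of_notMem (a := b) (by simp)]
    congr 1
    ext a
    simp only [Finset.mem_filter, Finset.mem_insert]
    grind
  · congr 1
    ext a
    simp only [Finset.mem_filter]
    grind

lemma below_insert {T : Finset ℕ} {x : ℕ} (hx : x ∉ T) (b : ℕ) :
    below (insert x T) b = below T b + if x < b then 1 else 0 := by
  unfold below
  rw [Finset.filter_insert]
  split_ifs with h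
  · rw [Finset.card_insert_of_notMem (by simp [hx])]
  · simp

lemma below_mono_gap (S : Finset ℕ) {x y : ℕ} (h : x ≤ y) :
    below S y + x ≤ below S x + y := by
  induction y, h using Nat.le_induction with
  | base => omega
  | succ y _ ih =>
    rw [below_succ]
    split_ifs <;> omega

lemma partOfBeta_insert {T : Finset ℕ} {x : ℕ} (hx : x ∉ T) :
    partOfBeta (insert x T) = ((x - below T x) ::ₘ
      T.val.map (fun b => b - (below T b + if x < b then 1 else 0))).filter (fun p => 0 < p) := by
  rw [partOfBeta_eq, Finset.insert_val_of_notMem hx, Multiset.map_cons, below_insert hx]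
  simp only [lt_irrefl, if_false, add_zero]
  congr 2
  exact Multiset.map_congr rfl fun b _ => by rw [below_insert hx]

lemma removeBox_cons (p : ℕ) (R : Multiset ℕ) :
    removeBox (p ::ₘ R) p = if p ≤ 1 then R else (p - 1) ::ₘ R := by
  simp [removeBox]

lemma partOfBeta_move_one {T : Finset ℕ} {x : ℕ} (hx : x ∉ T) (hx1 : x + 1 ∉ T) :
    partOfBeta (insert x T) =
      removeBox (partOfBeta (insert (x + 1) T)) (x + 1 - below (insert (x + 1) T) (x + 1)) := by
  have h1 : below T (x + 1) = below T x := by rw [below_succ]; simp [hx]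
  have hle := below_le T x
  have hR : T.val.map (fun b => b - (below T b + if x < b then 1 else 0)) =
      T.val.map (fun b => b - (below T b + if x + 1 < b then 1 else 0)) := by
    refine Multiset.map_congr rfl fun b hb => ?_
    have : b ≠ x + 1 := fun h => hx1 (h ▸ hb)
    have : x < b ↔ x + 1 < b := by omega
    simp only [this]
  rw [partOfBeta_insert hx, partOfBeta_insert hx1, hR, below_insert hx1, h1]
  simp only [lt_irrefl, if_false, add_zero]
  rw [Multiset.filter_cons_of_pos _ (by omega : 0 < x + 1 - below T x), removeBox_cons]
  split_ifs with h
  · rw [Multiset.filter_cons_of_neg _ (by omega)]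
  · rw [Multiset.filter_cons_of_pos _ (by omega)]
    congr 1
    omega

lemma partOfBeta_move_two {T : Finset ℕ} {x : ℕ} (hx : x ∉ T) (hx2 : x + 2 ∉ T) :
    (∃ p ∈ partOfBeta (insert (x + 2) T), 2 ≤ p ∧ p - 1 ∉ partOfBeta (insert (x + 2) T) ∧
      partOfBeta (insert x T) =
        ((p - 2) ::ₘ (partOfBeta (insert (x + 2) T)).erase p).filter (fun p => 0 < p)) ∨
    ∃ p R, 0 < p ∧ partOfBeta (insert (x + 2) T) = p ::ₘ p ::ₘ R ∧
      partOfBeta (insert x T) = ((p - 1) ::ₘ (p - 1) ::ₘ R).filter (fun p => 0 < p) := by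
  have hle := below_le T x
  have h1 : below T (x + 1) = below T x := by rw [below_succ]; simp [hx]
  by_cases hm : x + 1 ∈ T
  · right
    have h2 : below T (x + 2) = below T x + 1 := by rw [below_succ, h1]; simp [hm]
    have hR : (T.erase (x + 1)).val.map (fun b => b - (below T b + if x < b then 1 else 0)) =
        (T.erase (x + 1)).val.map (fun b => b - (below T b + if x + 2 < b then 1 else 0)) := by
      refine Multiset.map_congr rfl fun b hb => ?_
      have hb' : b ≠ x + 1 ∧ b ∈ T := Finset.mem_erase.1 hb
      have : b ≠ x + 2 := fun h => hx2 (h ▸ hb'.2)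
      have : x < b ↔ x + 2 < b := by omega
      simp only [this]
    have hT : T.val = (x + 1) ::ₘ (T.erase (x + 1)).val := by
      rw [Finset.erase_val]; exact (Multiset.cons_erase hm).symm
    refine ⟨x + 1 - below T x, ((T.erase (x + 1)).val.map
      (fun b => b - (below T b + if x + 2 < b then 1 else 0))).filter (fun p => 0 < p),
      by omega, ?_, ?_⟩
    · rw [partOfBeta_insert hx2, hT, Multiset.map_cons, h1, h2]
      simp only [show ¬ x + 2 < x + 1 by omega, if_false, add_zero]
      rw [Multiset.filter_cons_of_pos _ (by omega), Multiset.filter_cons_of_pos _ (by omega)]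
      congr 1
      omega
    · rw [partOfBeta_insert hx, hT, Multiset.map_cons, h1, hR]
      simp only [show x < x + 1 by omega, if_true]
      have e1 : x - below T x = x + 1 - below T x - 1 := by omega
      have e2 : x + 1 - (below T x + 1) = x + 1 - below T x - 1 := by omega
      rw [e1, e2]
      simp only [Multiset.filter_cons, Multiset.filter_filter, and_self]
  · left
    have h2 : below T (x + 2) = below T x := by rw [below_succ, h1]; simp [hm]
    have hR : T.val.map (fun b => b - (below T b + if x < b then 1 else 0)) =
        T.val.map (fun b => b - (below T b + if x + 2 < b then 1 else 0)) := by
      refine Multiset.map_congr rfl fun b hb => ?_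
      have : b ≠ x + 2 := fun h => hx2 (h ▸ hb)
      have : b ≠ x + 1 := fun h => hm (h ▸ hb)
      have : x < b ↔ x + 2 < b := by omega
      simp only [this]
    have hS := partOfBeta_insert hx2
    rw [Multiset.filter_cons_of_pos _ (by omega), h2] at hS
    refine ⟨x + 2 - below T x, ?_, by omega, ?_, ?_⟩
    · rw [hS]; simp
    · rw [hS]
      simp only [Multiset.mem_cons, Multiset.mem_filter, Multiset.mem_map]
      rintro (h | ⟨⟨b, hb, h⟩, -⟩)
      · omega
      · have hb2 : b ≠ x + 2 := fun h => hx2 (h ▸ hb)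
        have hb1 : b ≠ x + 1 := fun h => hm (h ▸ hb)
        have hb0 : b ≠ x := fun h => hx (h ▸ hb)
        rcases lt_or_gt_of_ne hb2 with hlt | hlt
        · have := below_mono_gap T (show b ≤ x by omega)
          have := below_le T b
          simp only [show ¬ x + 2 < b by omega, if_false] at h
          omega
        · have := below_mono_gap T (show x + 2 ≤ b by omega)
          rw [h2] at this
          have h3 := below_mono_gap T (show x + 3 ≤ b by omega)
          have h4 : below T (x + 3) = below T x := by rw [below_succ, h2]; simp [hx2]
          simp only [hlt, if_true] at h
          omega
    · rw [partOfBeta_insert hx, hR, hS, Multiset.erase_cons_head]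
      simp only [Multiset.filter_cons, Multiset.filter_filter, and_self]
      have : x - below T x = x + 2 - below T x - 2 := by omega
      rw [this]

lemma sum_filter_pos (M : Multiset ℕ) : (M.filter (fun p => 0 < p)).sum = M.sum := by
  induction M using Multiset.induction with
  | empty => simp
  | cons a M ih => by_cases h : 0 < a <;> simp [h, ih]; omega

lemma sum_partOfBeta_add (S : Finset ℕ) :
    (partOfBeta S).sum + ∑ i ∈ Finset.range S.card, i = ∑ b ∈ S, b := by
  induction S using Finset.induction_on_max with
  | empty => simp [partOfBeta]
  | insert x T hT ih =>
    have hx : x ∉ T := fun h => lt_irrefl _ (hT x h)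
    have hb : below T x = T.card := by
      unfold below
      rw [Finset.filter_true_of_mem hT]
    have hle := below_le T x
    have hR : T.val.map (fun b => b - (below T b + if x < b then 1 else 0)) =
        T.val.map (fun b => b - below T b) := by
      refine Multiset.map_congr rfl fun b hb => ?_
      have := hT b hb
      rw [if_neg (by omega), add_zero]
    rw [partOfBeta_insert hx, sum_filter_pos, Multiset.sum_cons, hR, Finset.sum_insert hx,
      Finset.card_insert_of_notMem hx, Finset.sum_range_succ, ← ih, partOfBeta_eq,
      sum_filter_pos]
    omega

lemma pos_of_mem_partOfBeta {S : Finset ℕ} {p : ℕ} (h : p ∈ partOfBeta S) : 0 < p :=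
  (Multiset.mem_filter.1 h).2

lemma degSYT_eq {lam : Multiset ℕ} (h : lam ≠ 0) (hpos : ∀ p ∈ lam, 0 < p) :
    degSYT lam = ∑ p ∈ lam.toFinset, degSYT (removeBox lam p) := by
  rw [degSYT, dif_neg h, Finset.sum_attach _ (fun p => degSYT (removeBox lam p)),
    Finset.filter_true_of_mem (by simpa using hpos)]

lemma degSYT_zero : degSYT 0 = 1 := by rw [degSYT]; simp

lemma degSYT_partOfBeta {S : Finset ℕ} (h : partOfBeta S ≠ 0) :
    degSYT (partOfBeta S) = ∑ x ∈ S.filter (fun x => 1 ≤ x ∧ x - 1 ∉ S),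
      degSYT (partOfBeta (insert (x - 1) (S.erase x))) := by
  rw [degSYT_eq h fun p hp => pos_of_mem_partOfBeta hp]
  symm
  refine Finset.sum_bij (fun x _ => x - below S x) ?_ ?_ ?_ ?_
  · intro x hx
    simp only [Finset.mem_filter] at hx
    obtain ⟨hxS, hx1, hx2⟩ := hx
    obtain ⟨y, rfl⟩ : ∃ y, x = y + 1 := ⟨x - 1, by omega⟩
    simp only [Multiset.mem_toFinset, partOfBeta_eq, Multiset.mem_filter, Multiset.mem_map]
    refine ⟨⟨y + 1, hxS, rfl⟩, ?_⟩
    rw [below_succ, if_neg (by simpa using hx2)]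
    have := below_le S y
    omega
  · have key : ∀ x y, x < y → x ∈ S → y - 1 ∉ S → x - below S x ≠ y - below S y := by
      intro x y hxy hx hy
      obtain ⟨z, rfl⟩ : ∃ z, y = z + 1 := ⟨y - 1, by omega⟩
      have h1 := below_mono_gap S (show x ≤ z by omega)
      have h2 := below_le S x
      have h3 := below_le S z
      rw [below_succ, if_neg (by simpa using hy)]
      omega
    intro x hx y hy hxy
    simp only [Finset.mem_filter] at hx hy
    rcases lt_trichotomy x y with h | h | h
    · exact absurd hxy (key x y h hx.1 hy.2.2)
    · exact h
    · exact absurd hxy.symm (key y x h hy.1 hx.2.2)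
  · intro p hp
    simp only [Multiset.mem_toFinset, partOfBeta_eq, Multiset.mem_filter, Multiset.mem_map] at hp
    obtain ⟨hp, hpos⟩ := hp
    have hex : ∃ y, y ∈ S ∧ y - below S y = p := hp
    have hs := Nat.find_spec hex
    have hmin := fun z => Nat.find_min hex (m := z)
    set y := Nat.find hex
    refine ⟨y, ?_, hs.2⟩
    simp only [Finset.mem_filter]
    refine ⟨hs.1, by omega, fun hy => ?_⟩
    obtain ⟨z, hz⟩ : ∃ z, y = z + 1 := ⟨y - 1, by omega⟩
    rw [hz] at hy hs hmin
    refine hmin z (by omega) ⟨by simpa using hy, ?_⟩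
    rw [← hs.2, below_succ, if_pos (by simpa using hy)]
    omega
  · intro x hx
    simp only [Finset.mem_filter] at hx
    obtain ⟨hxS, hx1, hx2⟩ := hx
    obtain ⟨y, rfl⟩ : ∃ y, x = y + 1 := ⟨x - 1, by omega⟩
    simp only [Nat.add_sub_cancel] at hx2 ⊢
    rw [partOfBeta_move_one (x := y) (by simp [hx2]) (by simp), Finset.insert_erase hxS]

open MvPolynomial in
/-- The sum over all permutations `σ` of the monomials `∏ X i ^ σ i`, i.e. the Vandermonde
determinant modulo `2`. -/
noncomputable def permSum (m : ℕ) : MvPolynomial (Fin m) (ZMod 2) :=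
  ∑ σ : Equiv.Perm (Fin m), monomial (Finsupp.equivFunOnFinite.symm fun i => (σ i : ℕ)) 1

open MvPolynomial in
lemma coeff_permSum (m : ℕ) (v : Fin m →₀ ℕ) : coeff v (permSum m) =
    ∑ σ : Equiv.Perm (Fin m), if ∀ i, (σ i : ℕ) = v i then 1 else 0 := by
  unfold permSum
  rw [coeff_sum]
  refine Finset.sum_congr rfl fun σ _ => ?_
  rw [coeff_monomial]
  congr 1
  simp [Finsupp.ext_iff]

open MvPolynomial in
lemma rename_permSum (m : ℕ) (τ : Equiv.Perm (Fin m)) :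
    rename τ (permSum m) = permSum m := by
  unfold permSum
  rw [map_sum]
  refine Fintype.sum_equiv (Equiv.mulRight τ⁻¹) _ _ fun σ => ?_
  rw [rename_monomial]
  refine congrArg (fun d => monomial d 1) (Finsupp.ext fun i => ?_)
  rw [Finsupp.mapDomain_equiv_apply]
  simp [Equiv.Perm.mul_apply]

open MvPolynomial in
/-- The polynomial whose coefficients are the degrees modulo `2` of the partitions of `n`. -/
noncomputable def degPoly (m n : ℕ) : MvPolynomial (Fin m) (ZMod 2) :=
  permSum m * (∑ i, X i) ^ n

open MvPolynomial in
lemma coeff_degPoly_mapDomain (m n : ℕ) (τ : Equiv.Perm (Fin m)) (v : Fin m →₀ ℕ) :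
    coeff (v.mapDomain τ) (degPoly m n) = coeff v (degPoly m n) := by
  have h : rename τ (degPoly m n) = degPoly m n := by
    unfold degPoly
    rw [map_mul, map_pow, rename_permSum, map_sum]
    simp only [rename_X]
    rw [Equiv.sum_comp τ (fun i => (X i : MvPolynomial (Fin m) (ZMod 2)))]
  conv_lhs => rw [← h]
  exact coeff_rename_mapDomain _ τ.injective _ _

open MvPolynomial in
lemma coeff_degPoly_succ (m n : ℕ) (v : Fin m →₀ ℕ) :
    coeff v (degPoly m (n + 1)) =
      ∑ i, if v i ≠ 0 then coeff (v - Finsupp.single i 1) (degPoly m n) else 0 := by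
  unfold degPoly
  rw [pow_succ, ← mul_assoc, Finset.mul_sum, coeff_sum]
  refine Finset.sum_congr rfl fun i _ => ?_
  rw [coeff_mul_X']
  simp only [Finsupp.mem_support_iff]

open MvPolynomial in
lemma coeff_degPoly_of_eq (m n : ℕ) (v : Fin m →₀ ℕ) {i j : Fin m} (hij : i ≠ j)
    (h : v i = v j) : coeff v (degPoly m n) = 0 := by
  induction n generalizing v with
  | zero =>
    simp only [degPoly, pow_zero, mul_one]
    rw [coeff_permSum]
    refine Finset.sum_eq_zero fun σ _ => if_neg fun hσ => hij ?_
    exact σ.injective (Fin.ext (by rw [hσ, hσ, h]))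
  | succ n ih =>
    rw [coeff_degPoly_succ]
    have hz : ∀ k, k ≠ i ∧ k ≠ j →
        (if v k ≠ 0 then coeff (v - Finsupp.single k 1) (degPoly m n) else 0) = 0 := by
      rintro k ⟨hi, hj⟩
      rw [ih _ (by simp [hi, hj, h]), ite_self]
    rw [Fintype.sum_eq_add i j hij hz]
    have hs : coeff (v - Finsupp.single j 1) (degPoly m n) =
        coeff (v - Finsupp.single i 1) (degPoly m n) := by
      rw [← coeff_degPoly_mapDomain m n (Equiv.swap i j)]
      congr 1
      ext k
      rw [Finsupp.mapDomain_equiv_apply, Equiv.symm_swap]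
      rcases eq_or_ne k i with rfl | hki
      · simp [h]
      rcases eq_or_ne k j with rfl | hkj
      · simp [h, hij, hij.symm]
      rw [Equiv.swap_apply_of_ne_of_ne hki hkj]
      simp [Ne.symm hki, Ne.symm hkj]
    rw [hs, h]
    exact CharTwo.add_self_eq_zero _

lemma eq_range_of_partOfBeta_eq_zero {S : Finset ℕ} (h : partOfBeta S = 0) :
    S = Finset.range S.card := by
  refine Finset.eq_of_subset_of_card_le (fun b hb => ?_) (by simp)
  have hb' : b - below S b = 0 := by
    by_contra hne
    have : b - below S b ∈ partOfBeta S := by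
      rw [partOfBeta_eq, Multiset.mem_filter]
      exact ⟨Multiset.mem_map_of_mem _ hb, by omega⟩
    simp [h] at this
  have hle : below S (b + 1) ≤ S.card := Finset.card_filter_le _ _
  rw [below_succ, if_pos hb] at hle
  simp
  omega

open MvPolynomial in
lemma coeff_degPoly_eq_degSYT (m n : ℕ) (v : Fin m →₀ ℕ) (hv : Function.Injective v)
    (hs : (partOfBeta (Finset.univ.image v)).sum = n) :
    coeff v (degPoly m n) = degSYT (partOfBeta (Finset.univ.image v)) := by
  have hcard : (Finset.univ.image v).card = m := by
    rw [Finset.card_image_of_injective _ hv]; simp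
  induction n generalizing v with
  | zero =>
    have h0 : partOfBeta (Finset.univ.image v) = 0 := by
      refine Multiset.eq_zero_of_forall_notMem fun p hp => ?_
      have := pos_of_mem_partOfBeta hp
      have := Multiset.single_le_sum (fun _ _ => Nat.zero_le _) p hp
      omega
    have hr := eq_range_of_partOfBeta_eq_zero h0
    rw [hcard] at hr
    have hlt : ∀ i, v i < m := fun i => by
      have : v i ∈ Finset.univ.image v := by simp
      rw [hr] at this
      simpa using this
    have hinj : Function.Injective (fun i => (⟨v i, hlt i⟩ : Fin m)) := fun i j hij =>
      hv (Fin.ext_iff.1 hij)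
    let σ : Equiv.Perm (Fin m) := Equiv.ofBijective _ (Finite.injective_iff_bijective.1 hinj)
    rw [h0, degSYT_zero, degPoly, pow_zero, mul_one, coeff_permSum,
      Finset.sum_eq_single σ]
    · simp [σ]
    · intro τ _ hτ
      refine if_neg fun h => hτ ?_
      ext i
      simp [σ, h]
    · simp
  | succ n ih =>
    have h0 : partOfBeta (Finset.univ.image v) ≠ 0 := fun h => by simp [h] at hs
    rw [coeff_degPoly_succ, degSYT_partOfBeta h0, Finset.sum_filter,
      Finset.sum_image (fun i _ j _ h => hv h), Nat.cast_sum]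
    refine Finset.sum_congr rfl fun i _ => ?_
    by_cases hi : v i = 0
    · simp [hi]
    rw [if_pos hi]
    set w := v - Finsupp.single i 1 with hw
    have hwi : w i = v i - 1 := by simp [hw]
    have hwj : ∀ j, j ≠ i → w j = v j := fun j hj => by simp [hw, hj]
    by_cases hm : v i - 1 ∈ Finset.univ.image v
    · rw [if_neg (by tauto), Nat.cast_zero]
      obtain ⟨j, -, hj⟩ := Finset.mem_image.1 hm
      have hji : j ≠ i := by rintro rfl; omega
      exact coeff_degPoly_of_eq m n w hji (by rw [hwi, hwj j hji, hj])
    · rw [if_pos ⟨by omega, hm⟩]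
      have himg : Finset.univ.image w =
          insert (v i - 1) ((Finset.univ.image v).erase (v i)) := by
        ext y
        simp only [Finset.mem_image, Finset.mem_univ, true_and, Finset.mem_insert,
          Finset.mem_erase]
        constructor
        · rintro ⟨j, rfl⟩
          by_cases hj : j = i
          · left; rw [hj, hwi]
          · right; rw [hwj j hj]
            exact ⟨fun h => hj (hv h), j, rfl⟩
        · rintro (rfl | ⟨hne, j, rfl⟩)
          · exact ⟨i, hwi⟩
          · exact ⟨j, hwj j (by rintro rfl; exact hne rfl)⟩
      have hwinj : Function.Injective w := by
        intro j k hjk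
        by_cases hj : j = i <;> by_cases hk : k = i
        · rw [hj, hk]
        · rw [hj, hwi, hwj k hk] at hjk
          exact absurd (Finset.mem_image.2 ⟨k, Finset.mem_univ _, hjk.symm⟩) hm
        · rw [hk, hwi, hwj j hj] at hjk
          exact absurd (Finset.mem_image.2 ⟨j, Finset.mem_univ _, hjk⟩) hm
        · rw [hwj j hj, hwj k hk] at hjk
          exact hv hjk
      have hwcard : (Finset.univ.image w).card = m := by
        rw [Finset.card_image_of_injective _ hwinj]; simp
      rw [← himg]
      refine ih w hwinj ?_ hwcard
      have e1 := sum_partOfBeta_add (Finset.univ.image v)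
      have e2 := sum_partOfBeta_add (Finset.univ.image w)
      rw [hcard, Finset.sum_image (fun i _ j _ h => hv h)] at e1
      rw [hwcard, Finset.sum_image (fun i _ j _ h => hwinj h)] at e2
      have e3 : ∑ j, v j = ∑ j, w j + 1 := by
        have : ∑ j ∈ Finset.univ.erase i, w j = ∑ j ∈ Finset.univ.erase i, v j :=
          Finset.sum_congr rfl fun j hj => hwj j (Finset.ne_of_mem_erase hj)
        rw [← Finset.add_sum_erase _ (fun j => v j) (Finset.mem_univ i),
          ← Finset.add_sum_erase _ (fun j => w j) (Finset.mem_univ i), hwi, this]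
        omega
      omega

open MvPolynomial in
lemma card_filter_one_lt_partOfBeta {m t : ℕ} (v : Fin m →₀ ℕ) (hv : Function.Injective v)
    (hs : (partOfBeta (Finset.univ.image v)).sum = 2 ^ t)
    (hodd : Odd (degSYT (partOfBeta (Finset.univ.image v)))) :
    ((partOfBeta (Finset.univ.image v)).filter (fun p => 1 < p)).card ≤ 1 := by
  have h := coeff_degPoly_eq_degSYT m _ v hv hs
  have hne : coeff v (degPoly m (2 ^ t)) ≠ 0 := by
    rw [h, Ne, ZMod.natCast_eq_zero_iff]
    exact fun hd => (Nat.not_even_iff_odd.2 hodd) (even_iff_two_dvd.2 hd)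
  rw [degPoly, sum_pow_char_pow, Finset.mul_sum, coeff_sum] at hne
  obtain ⟨i, -, hi⟩ := Finset.exists_ne_zero_of_sum_ne_zero hne
  rw [X_pow_eq_monomial, coeff_mul_monomial', mul_one] at hi
  have hi2 := (ite_ne_right_iff.1 hi).2
  rw [coeff_permSum] at hi2
  obtain ⟨σ, -, hσ⟩ := Finset.exists_ne_zero_of_sum_ne_zero hi2
  have hσ' : ∀ j, j ≠ i → (σ j : ℕ) = v j := fun j hj => by
    have := (ite_ne_right_iff.1 hσ).1 j
    simpa [hj] using this
  rw [partOfBeta_eq, Multiset.filter_filter, Multiset.filter_map, Multiset.card_map]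
  change (Finset.filter _ (Finset.univ.image v)).card ≤ 1
  refine (Finset.card_le_card (t := {v i}) fun b hb => ?_).trans (Finset.card_singleton _).le
  simp only [Finset.mem_filter, Finset.mem_image, Finset.mem_univ, true_and,
    Function.comp_apply] at hb
  obtain ⟨⟨j, rfl⟩, hb, -⟩ := hb
  by_contra hj
  have hji : j ≠ i := by rintro rfl; simp at hj
  have hlow : v j - 1 ≤ below (Finset.univ.image v) (v j) := by
    calc v j - 1 ≤ ((Finset.range (v j)).erase (σ i)).card := by
          have := Finset.pred_card_le_card_erase (s := Finset.range (v j)) (a := (σ i : ℕ))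
          simpa using this
      _ ≤ _ := Finset.card_le_card fun c hc => by
          simp only [Finset.mem_erase, Finset.mem_range] at hc
          have hcm : c < m := by have := (σ j).2; have := hσ' j hji; omega
          have hk : (σ (σ.symm ⟨c, hcm⟩) : ℕ) = c := by simp
          have hki : σ.symm ⟨c, hcm⟩ ≠ i := fun h => hc.1 (by rw [← h, hk])
          simp only [Finset.mem_filter, Finset.mem_image, Finset.mem_univ, true_and]
          exact ⟨⟨_, by rw [← hσ' _ hki, hk]⟩, hc.2⟩
  omega

lemma coe_descList (lam : Multiset ℕ) : (descList lam : Multiset ℕ) = lam := by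
  rw [descList, ← Multiset.coe_reverse, List.reverse_reverse]
  exact Multiset.sort_eq lam _

lemma length_descList (lam : Multiset ℕ) : (descList lam).length = lam.card := by
  simp [descList]

lemma pairwise_descList (lam : Multiset ℕ) : (descList lam).Pairwise (· ≥ ·) := by
  rw [descList, List.pairwise_reverse]
  exact Multiset.pairwise_sort lam _

lemma descList_coe {l : List ℕ} (h : l.Pairwise (· ≥ ·)) : descList (l : Multiset ℕ) = l :=
  List.Perm.eq_of_pairwise (fun _ _ _ _ h1 h2 => le_antisymm h2 h1)
    (pairwise_descList _) h (Multiset.coe_eq_coe.1 (coe_descList _))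

/-- The part of `lam` in row `i`, rows being numbered from `0`. -/
def row (lam : Multiset ℕ) (i : ℕ) : ℕ := (descList lam).getD i 0

lemma row_antitone (lam : Multiset ℕ) {i j : ℕ} (h : i ≤ j) : row lam j ≤ row lam i := by
  unfold row
  rcases lt_or_ge j (descList lam).length with hj | hj
  · rw [List.getD_eq_getElem _ _ hj, List.getD_eq_getElem _ _ (h.trans_lt hj)]
    rcases h.eq_or_lt with rfl | hlt
    · rfl
    · exact List.pairwise_iff_getElem.1 (pairwise_descList lam) i j _ _ hlt
  · rw [List.getD_eq_default _ _ hj]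
    exact Nat.zero_le _

lemma betaSet_eq (lam : Multiset ℕ) (m : ℕ) :
    betaSet lam m = (Finset.range m).image (fun i => row lam i + (m - 1 - i)) := rfl

lemma bead_lt (lam : Multiset ℕ) {m i j : ℕ} (hij : i < j) (hj : j < m) :
    row lam j + (m - 1 - j) < row lam i + (m - 1 - i) := by
  have := row_antitone lam hij.le
  omega

lemma bead_injOn (lam : Multiset ℕ) (m : ℕ) :
    Set.InjOn (fun i => row lam i + (m - 1 - i)) (Finset.range m) := by
  intro i hi j hj h
  simp only [Finset.coe_range, Set.mem_Iio] at hi hj h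
  rcases lt_trichotomy i j with hij | hij | hij
  · have := bead_lt lam hij hj; omega
  · exact hij
  · have := bead_lt lam hij hi; omega

lemma map_row_range (lam : Multiset ℕ) {m : ℕ} (hm : lam.card ≤ m) :
    (Multiset.range m).map (row lam) = lam + Multiset.replicate (m - lam.card) 0 := by
  have : (List.range m).map (row lam) = descList lam ++ List.replicate (m - lam.card) 0 := by
    apply List.ext_getElem
    · simp [length_descList]; omega
    · intro i h1 h2
      simp only [List.getElem_map, List.getElem_range, row]
      rw [List.getElem_append]
      split_ifs with h
      · rw [List.getD_eq_getElem _ _ h]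
      · rw [List.getD_eq_default _ _ (by omega), List.getElem_replicate]
  rw [← Multiset.coe_range, Multiset.map_coe, this, ← Multiset.coe_add, coe_descList,
    Multiset.coe_replicate]

lemma partOfBeta_betaSet {lam : Multiset ℕ} (hpos : ∀ x ∈ lam, 0 < x) {m : ℕ}
    (hm : lam.card ≤ m) : partOfBeta (betaSet lam m) = lam := by
  rw [partOfBeta_eq]
  have h1 : (betaSet lam m).val =
      (Multiset.range m).map (fun i => row lam i + (m - 1 - i)) := by
    rw [betaSet_eq, Finset.image_val_of_injOn (bead_injOn lam m)]
    rfl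
  have h2 : ∀ i ∈ Multiset.range m,
      row lam i + (m - 1 - i) - below (betaSet lam m) (row lam i + (m - 1 - i)) = row lam i := by
    intro i hi
    rw [Multiset.mem_range] at hi
    have : below (betaSet lam m) (row lam i + (m - 1 - i)) = m - 1 - i := by
      have : (betaSet lam m).filter (fun a => a < row lam i + (m - 1 - i)) =
          (Finset.Ico (i + 1) m).image (fun i => row lam i + (m - 1 - i)) := by
        ext a
        simp only [betaSet_eq, Finset.mem_filter, Finset.mem_image, Finset.mem_range,
          Finset.mem_Ico]
        constructor
        · rintro ⟨⟨j, hj, rfl⟩, hlt⟩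
          refine ⟨j, ⟨?_, hj⟩, rfl⟩
          by_contra hle
          rcases (show j ≤ i by omega).eq_or_lt with rfl | h
          · omega
          · have := bead_lt lam h hi; omega
        · rintro ⟨j, hj, rfl⟩
          exact ⟨⟨j, hj.2, rfl⟩, bead_lt lam hj.1 hj.2⟩
      rw [below, this, Finset.card_image_of_injOn, Nat.card_Ico]
      · omega
      · exact (bead_injOn lam m).mono fun x hx => by
          simp only [Finset.coe_Ico, Set.mem_Ico] at hx; simp [hx.2]
    rw [this]
    omega
  rw [h1, Multiset.map_map]
  simp only [Function.comp_def]
  rw [Multiset.map_congr rfl h2, map_row_range lam hm, Multiset.filter_add,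
    Multiset.filter_eq_self.2 hpos, Multiset.filter_eq_nil.2, add_zero]
  intro x hx
  simp [Multiset.eq_of_mem_replicate hx]

/-- An odd partition of `2 ^ t` is a hook. -/
lemma card_filter_one_lt_of_oddP {lam : Multiset ℕ} (h : OddP lam) {t : ℕ}
    (hs : lam.sum = 2 ^ t) : (lam.filter (fun p => 1 < p)).card ≤ 1 := by
  let v : Fin lam.card →₀ ℕ :=
    Finsupp.equivFunOnFinite.symm fun i => row lam i + (lam.card - 1 - i)
  have hv : Function.Injective v := fun i j hij =>
    Fin.ext (bead_injOn lam lam.card (by simp) (by simp) hij)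
  have himg : Finset.univ.image v = betaSet lam lam.card := by
    ext b
    simp only [betaSet_eq, Finset.mem_image, Finset.mem_univ, true_and, Finset.mem_range, v,
      Finsupp.equivFunOnFinite_symm_apply_apply]
    exact ⟨fun ⟨i, hi⟩ => ⟨i, i.2, hi⟩, fun ⟨i, hi, hb⟩ => ⟨⟨i, hi⟩, hb⟩⟩
  have key := card_filter_one_lt_partOfBeta (t := t) v hv
  rw [himg, partOfBeta_betaSet h.1 le_rfl] at key
  exact key hs h.2

lemma IsHookRemoval.eq_partOfBeta {e : ℕ} {lam mu : Multiset ℕ} (h : IsHookRemoval e lam mu) :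
    ∃ (T : Finset ℕ) (x : ℕ), x ∉ T ∧ x + e ∉ T ∧ lam = partOfBeta (insert (x + e) T) ∧
      mu = partOfBeta (insert x T) := by
  obtain ⟨hl, hm, he, m, x, hlm, hmm, hx, hex, hx', hmu⟩ := h
  refine ⟨(betaSet lam m).erase x, x - e, fun h => hx' (Finset.mem_of_mem_erase h), ?_, ?_, ?_⟩
  · rw [Nat.sub_add_cancel hex]; simp
  · rw [Nat.sub_add_cancel hex, Finset.insert_erase hx, partOfBeta_betaSet hl hlm]
  · rw [← hmu, partOfBeta_betaSet hm hmm]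

lemma IsHookRemoval.one {lam mu : Multiset ℕ} (h : IsHookRemoval 1 lam mu) :
    ∃ p ∈ lam, mu = removeBox lam p := by
  obtain ⟨T, x, hx, hx1, rfl, rfl⟩ := h.eq_partOfBeta
  refine ⟨_, ?_, partOfBeta_move_one hx hx1⟩
  rw [partOfBeta_eq, Multiset.mem_filter]
  refine ⟨Multiset.mem_map_of_mem _ (Finset.mem_insert_self _ _), ?_⟩
  rw [below_insert hx1, below_succ]
  have := below_le T x
  simp [hx]
  omega

lemma IsHookRemoval.two {lam mu : Multiset ℕ} (h : IsHookRemoval 2 lam mu) :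
    (∃ p ∈ lam, 2 ≤ p ∧ p - 1 ∉ lam ∧
      mu = ((p - 2) ::ₘ lam.erase p).filter (fun p => 0 < p)) ∨
    ∃ p R, 0 < p ∧ lam = p ::ₘ p ::ₘ R ∧
      mu = ((p - 1) ::ₘ (p - 1) ::ₘ R).filter (fun p => 0 < p) := by
  obtain ⟨T, x, hx, hx2, rfl, rfl⟩ := h.eq_partOfBeta
  exact partOfBeta_move_two hx hx2

/-- Shortening a single row by `e` boxes is the removal of an `e`-hook. -/
lemma isHookRemoval_of_row {e r : ℕ} {lam mu : Multiset ℕ} (hl : ∀ x ∈ lam, 0 < x)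
    (hm : ∀ x ∈ mu, 0 < x) (he : 0 < e) (hr : r < lam.card) (hmu : mu.card ≤ lam.card)
    (hrow : row lam r = row mu r + e) (hne : ∀ i, i ≠ r → row mu i = row lam i) :
    IsHookRemoval e lam mu := by
  refine ⟨hl, hm, he, lam.card, row lam r + (lam.card - 1 - r), le_rfl, hmu, ?_, by omega, ?_, ?_⟩
  · exact Finset.mem_image.2 ⟨r, Finset.mem_range.2 hr, rfl⟩
  · rw [betaSet_eq, Finset.mem_image]
    rintro ⟨j, hj, h⟩
    by_cases hjr : j = r
    · subst hjr; omega
    · refine hjr (bead_injOn mu lam.card hj (by simpa using hr) ?_)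
      simp only [hne j hjr]
      omega
  · ext y
    simp only [betaSet_eq, Finset.mem_insert, Finset.mem_erase, Finset.mem_image, Finset.mem_range]
    constructor
    · rintro ⟨j, hj, rfl⟩
      by_cases hjr : j = r
      · left; subst hjr; omega
      · right
        rw [hne j hjr]
        exact ⟨fun h => hjr (bead_injOn lam lam.card (by simpa using hj) (by simpa using hr) h),
          j, hj, rfl⟩
    · rintro (rfl | ⟨h, j, hj, rfl⟩)
      · exact ⟨r, hr, by omega⟩
      · exact ⟨j, hj, by rw [hne j (by rintro rfl; exact h rfl)]⟩

lemma fkOp_eq {k : ℕ} {lam mu : Multiset ℕ} (h : IsHookRemoval (2 ^ k) lam mu) (ho : OddP mu)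
    (huniq : ∀ nu, IsHookRemoval (2 ^ k) lam nu → OddP nu → nu = mu) : fkOp k lam = mu := by
  have hex : ∃ mu, IsHookRemoval (2 ^ k) lam mu ∧ OddP mu := ⟨mu, h, ho⟩
  rw [fkOp, dif_pos hex]
  exact huniq _ hex.choose_spec.1 hex.choose_spec.2

lemma fkOp_spec (k : ℕ) (lam : Multiset ℕ) :
    fkOp k lam = 0 ∨ IsHookRemoval (2 ^ k) lam (fkOp k lam) := by
  unfold fkOp
  split_ifs with h
  · exact Or.inr h.choose_spec.1
  · exact Or.inl rfl

lemma degSYT_one_size {p : ℕ} {R : Multiset ℕ} (hp : 0 < p) (hR : ∀ x ∈ R, x = p) :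
    degSYT (p ::ₘ R) = degSYT (removeBox (p ::ₘ R) p) := by
  have hf : (p ::ₘ R).toFinset = {p} := by
    ext x
    simp only [Multiset.mem_toFinset, Multiset.mem_cons, Finset.mem_singleton]
    exact ⟨fun h => h.elim id (hR x), Or.inl⟩
  rw [degSYT_eq (Multiset.cons_ne_zero) fun x hx => by
    rcases Multiset.mem_cons.1 hx with rfl | h
    · exact hp
    · rw [hR x h]; exact hp, hf, Finset.sum_singleton]

lemma degSYT_two_sizes {p q : ℕ} {R : Multiset ℕ} (hp : 0 < p) (hq : 0 < q) (hpq : p ≠ q)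
    (hR : ∀ x ∈ R, x = p ∨ x = q) : degSYT (p ::ₘ q ::ₘ R) =
      degSYT (removeBox (p ::ₘ q ::ₘ R) p) + degSYT (removeBox (q ::ₘ p ::ₘ R) q) := by
  have hf : (p ::ₘ q ::ₘ R).toFinset = {p, q} := by
    ext x
    simp only [Multiset.mem_toFinset, Multiset.mem_cons, Finset.mem_singleton, Finset.mem_insert]
    have := hR x
    tauto
  rw [degSYT_eq (Multiset.cons_ne_zero) fun x hx => by
    rw [← Multiset.mem_toFinset, hf, Finset.mem_insert, Finset.mem_singleton] at hx
    rcases hx with rfl | rfl <;> assumption, hf, Finset.sum_pair hpq, Multiset.cons_swap p q]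

lemma degSYT_column (n : ℕ) : degSYT (Multiset.replicate n 1) = 1 := by
  induction n with
  | zero => exact degSYT_zero
  | succ n ih =>
    rw [Multiset.replicate_succ, degSYT_one_size one_pos fun x => Multiset.eq_of_mem_replicate,
      removeBox_cons, if_pos le_rfl, ih]

lemma degSYT_hook (a b : ℕ) :
    degSYT ((a + 1) ::ₘ Multiset.replicate b 1) = (a + b).choose b := by
  induction a generalizing b with
  | zero => rw [zero_add, zero_add, ← Multiset.replicate_succ, degSYT_column, Nat.choose_self]
  | succ a iha =>
    induction b with
    | zero =>
      rw [degSYT_one_size (by omega) (by simp), removeBox_cons, if_neg (by omega)]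
      simpa using iha 0
    | succ b ihb =>
      rw [Multiset.replicate_succ, degSYT_two_sizes (by omega) one_pos (by omega)
        fun x hx => Or.inr (Multiset.eq_of_mem_replicate hx), removeBox_cons, removeBox_cons,
        if_neg (by omega), if_pos le_rfl, ihb, ← Multiset.replicate_succ, Nat.add_sub_cancel, iha,
        show a + 1 + (b + 1) = (a + 1 + b) + 1 by ring, Nat.choose_succ_succ,
        show a + (b + 1) = a + 1 + b by ring]
      ring

lemma two_mul_degSYT_two_rows (a : ℕ) :
    2 * degSYT ((a + 2) ::ₘ 2 ::ₘ 0) = (a + 4) * (a + 1) := by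
  induction a with
  | zero =>
    rw [degSYT_one_size (by omega) (by simp), removeBox_cons, if_neg (by omega)]
    have := degSYT_hook 1 1
    simp only [Multiset.replicate_one] at this
    rw [Multiset.cons_swap]
    change 2 * degSYT (2 ::ₘ {1}) = 4
    change degSYT (2 ::ₘ {1}) = 2 at this
    rw [this]
  | succ a ih =>
    rw [degSYT_two_sizes (by omega) (by omega) (by omega) (by simp), removeBox_cons,
      removeBox_cons, if_neg (by omega), if_neg (by omega), Multiset.cons_swap (2 - 1)]
    have h := degSYT_hook (a + 2) 1
    rw [Multiset.replicate_one, Nat.choose_one_right] at h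
    rw [mul_add, show a + 1 + 2 - 1 = a + 2 by omega, ih]
    change _ + 2 * degSYT ((a + 2 + 1) ::ₘ {1}) = _
    rw [h]
    ring

lemma two_mul_degSYT_two_columns (k : ℕ) :
    2 * degSYT (2 ::ₘ 2 ::ₘ Multiset.replicate k 1) = (k + 4) * (k + 1) := by
  induction k with
  | zero => exact two_mul_degSYT_two_rows 0
  | succ k ih =>
    rw [Multiset.replicate_succ, Multiset.cons_swap 2 1, degSYT_two_sizes (by omega) (by omega)
      (by omega) (fun x hx => by
        rcases Multiset.mem_cons.1 hx with rfl | hx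
        · exact Or.inl rfl
        · exact Or.inr (Multiset.eq_of_mem_replicate hx)), removeBox_cons, removeBox_cons,
      if_neg (by omega), if_pos le_rfl, mul_add, ih, Multiset.cons_swap 1 2,
      ← Multiset.replicate_succ]
    have h := degSYT_hook 1 (k + 2)
    rw [show 1 + (k + 2) = k + 2 + 1 by ring, Nat.choose_succ_self_right] at h
    simp only [Nat.reduceSub, ← Multiset.replicate_succ, Multiset.cons_swap 1 2]
    rw [show (2 : ℕ) = 1 + 1 from rfl] at *
    rw [h]
    ring

lemma odd_choose_of_add_one_eq {n t : ℕ} (h : n + 1 = 2 ^ t) {b : ℕ} (hb : b ≤ n) :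
    Odd (n.choose b) := by
  induction b with
  | zero => simp
  | succ b ih =>
    have h1 := ih (by omega)
    have h2 : Even ((n + 1).choose (b + 1)) := by
      rw [h, even_iff_two_dvd]
      exact Nat.prime_two.dvd_choose_pow (by omega) (by omega)
    rw [Nat.choose_succ_succ] at h2
    exact (Nat.even_add'.1 h2).1 h1

lemma odd_choose_iff_of_add_two_eq {n t : ℕ} (h : n + 2 = 2 ^ t) {b : ℕ} (hb : b ≤ n) :
    Odd (n.choose b) ↔ Even b := by
  induction b with
  | zero => simp
  | succ b ih =>
    have h1 := ih (by omega)
    have h2 := odd_choose_of_add_one_eq (n := n + 1) h (show b + 1 ≤ n + 1 by omega)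
    rw [Nat.choose_succ_succ, Nat.odd_add] at h2
    rw [← Nat.not_even_iff_odd, ← h2, h1, Nat.even_add_one]

lemma pos_of_mem_hook {a b x : ℕ} (hx : x ∈ (a + 1) ::ₘ Multiset.replicate b 1) : 0 < x := by
  rcases Multiset.mem_cons.1 hx with rfl | h
  · omega
  · rw [Multiset.eq_of_mem_replicate h]; exact one_pos

lemma oddP_hook {a b : ℕ} :
    OddP ((a + 1) ::ₘ Multiset.replicate b 1) ↔ Odd ((a + b).choose b) := by
  rw [OddP, degSYT_hook]
  exact and_iff_right fun x hx => pos_of_mem_hook hx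

lemma exists_hook {lam : Multiset ℕ} (hpos : ∀ x ∈ lam, 0 < x) (h0 : lam ≠ 0)
    (h : (lam.filter (fun p => 1 < p)).card ≤ 1) :
    ∃ a b, lam = (a + 1) ::ₘ Multiset.replicate b 1 := by
  have h1 : lam.filter (fun p => ¬ 1 < p) =
      Multiset.replicate (lam.filter (fun p => ¬ 1 < p)).card 1 := by
    refine Multiset.eq_replicate.2 ⟨rfl, fun x hx => ?_⟩
    rw [Multiset.mem_filter] at hx
    have := hpos x hx.1
    omega
  have h2 := Multiset.filter_add_not (fun p => 1 < p) lam
  rw [h1] at h2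
  generalize (lam.filter (fun p => ¬ 1 < p)).card = c at h2
  rcases Nat.le_one_iff_eq_zero_or_eq_one.1 h with h | h
  · rw [Multiset.card_eq_zero.1 h, zero_add] at h2
    cases c with
    | zero => exact absurd h2.symm h0
    | succ c => exact ⟨0, c, by rw [← h2, Multiset.replicate_succ]⟩
  · obtain ⟨p, hp⟩ := Multiset.card_eq_one.1 h
    have hp1 : p ∈ lam.filter (fun p => 1 < p) := by simp [hp]
    have := (Multiset.mem_filter.1 hp1).2
    refine ⟨p - 1, c, ?_⟩
    rw [← h2, hp, Multiset.singleton_add, Nat.sub_add_cancel (by omega)]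

lemma pos_of_mem_removeBox {lam : Multiset ℕ} (hpos : ∀ x ∈ lam, 0 < x) {p : ℕ} :
    ∀ x ∈ removeBox lam p, 0 < x := by
  intro x hx
  unfold removeBox at hx
  split_ifs at hx with h
  · exact hpos x (Multiset.mem_of_mem_erase hx)
  · rcases Multiset.mem_cons.1 hx with rfl | hx
    · omega
    · exact hpos x (Multiset.mem_of_mem_erase hx)

/-- Classification of the odd partitions of `2 ^ t + 1`. -/
lemma eq_of_oddP_of_sum {lam : Multiset ℕ} (h : OddP lam) {t : ℕ} (hs : lam.sum = 2 ^ t + 1) :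
    lam = {2 ^ t + 1} ∨ lam = Multiset.replicate (2 ^ t + 1) 1 ∨
      ∃ a k, a + k + 3 = 2 ^ t ∧ lam = (a + 2) ::ₘ 2 ::ₘ Multiset.replicate k 1 := by
  have hook : ∀ a b, lam = (a + 1) ::ₘ Multiset.replicate b 1 →
      lam = {2 ^ t + 1} ∨ lam = Multiset.replicate (2 ^ t + 1) 1 := by
    rintro a b rfl
    simp only [Multiset.sum_cons, Multiset.sum_replicate, smul_eq_mul, mul_one] at hs
    have hodd := oddP_hook.1 h
    rw [show a + b = 2 ^ t by omega] at hodd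
    by_cases hb : b = 0
    · left
      subst hb
      rw [← hs]
      rfl
    by_cases ha : a = 0
    · right
      subst ha
      rw [← hs, zero_add, ← Multiset.replicate_succ, add_comm]
    exact absurd (even_iff_two_dvd.2 (Nat.prime_two.dvd_choose_pow hb (by omega)))
      (Nat.not_even_iff_odd.2 hodd)
  have h0 : lam ≠ 0 := by rintro rfl; simp at hs
  obtain ⟨hpos, hodd⟩ := h
  have hodd' := hodd
  rw [degSYT_eq h0 hpos] at hodd'
  obtain ⟨p, hp, hpo⟩ : ∃ p ∈ lam, Odd (degSYT (removeBox lam p)) := by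
    by_contra hne
    push Not at hne
    refine Nat.not_even_iff_odd.2 hodd' (Finset.even_sum _ fun p hp => ?_)
    exact Nat.not_odd_iff_even.1 (hne p (Multiset.mem_toFinset.1 hp))
  have hp0 := hpos p hp
  have hro : OddP (removeBox lam p) := ⟨pos_of_mem_removeBox hpos, hpo⟩
  obtain ⟨R, rfl⟩ := Multiset.exists_cons_of_mem hp
  rw [Multiset.sum_cons] at hs
  have hrs : (removeBox (p ::ₘ R) p).sum = 2 ^ t := by
    rw [removeBox_cons]
    split_ifs
    · omega
    · rw [Multiset.sum_cons]; omega
  have hr0 : removeBox (p ::ₘ R) p ≠ 0 := fun h => by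
    rw [h, Multiset.sum_zero] at hrs
    exact absurd hrs.symm (by positivity)
  obtain ⟨a, b, hab⟩ := exists_hook hro.1 hr0 (card_filter_one_lt_of_oddP hro hrs)
  rw [hab, Multiset.sum_cons, Multiset.sum_replicate, smul_eq_mul, mul_one] at hrs
  rw [removeBox_cons] at hab
  split_ifs at hab with hp1
  · obtain rfl : p = 1 := by omega
    have := hook a (b + 1) (by rw [hab, Multiset.replicate_succ, Multiset.cons_swap])
    tauto
  · rcases Multiset.cons_eq_cons.1 hab with ⟨h1, rfl⟩ | ⟨-, cs, rfl, h2⟩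
    · have := hook (a + 1) b (by rw [← h1]; congr 1; omega)
      tauto
    · have hm : p - 1 ∈ Multiset.replicate b 1 := by rw [h2]; simp
      have hp2 := Multiset.eq_of_mem_replicate hm
      cases b with
      | zero => simp at hm
      | succ b =>
        rw [hp2, Multiset.replicate_succ, Multiset.cons_inj_right] at h2
        obtain rfl : p = 2 := by omega
        subst h2
        cases a with
        | zero =>
          have := hook 1 (b + 1) (by rw [Multiset.replicate_succ])
          tauto
        | succ a =>
          exact Or.inr (Or.inr ⟨a, b, by omega, Multiset.cons_swap _ _ _⟩)

lemma row_coe {l : List ℕ} (h : l.Pairwise (· ≥ ·)) (i : ℕ) :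
    row (l : Multiset ℕ) i = l.getD i 0 := by
  rw [row, descList_coe h]

lemma getD_replicate_one (k i : ℕ) : (List.replicate k 1).getD i 0 = if i < k then 1 else 0 := by
  split_ifs with h
  · rw [List.getD_eq_getElem _ _ (by simpa using h), List.getElem_replicate]
  · rw [List.getD_eq_default _ _ (by simpa using h)]

lemma row_column (n i : ℕ) : row (Multiset.replicate n 1) i = if i < n then 1 else 0 := by
  rw [← Multiset.coe_replicate, row_coe (List.pairwise_replicate.2 (Or.inr le_rfl)),
    getD_replicate_one]

lemma row_hook (a b i : ℕ) : row ((a + 1) ::ₘ Multiset.replicate b 1) i =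
    if i = 0 then a + 1 else if i - 1 < b then 1 else 0 := by
  rw [← Multiset.coe_replicate, Multiset.cons_coe, row_coe]
  · cases i <;> simp [-List.getD_eq_getElem?_getD, List.getD_cons_zero,
      List.getD_cons_succ, getD_replicate_one]
  · simp only [List.pairwise_cons, List.mem_replicate, List.pairwise_replicate]
    grind

lemma row_near_hook (a k i : ℕ) : row ((a + 2) ::ₘ 2 ::ₘ Multiset.replicate k 1) i =
    if i = 0 then a + 2 else if i = 1 then 2 else if i - 2 < k then 1 else 0 := by
  rw [← Multiset.coe_replicate, Multiset.cons_coe, Multiset.cons_coe, row_coe]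
  · rcases i with _ | _ | i <;> simp [-List.getD_eq_getElem?_getD, List.getD_cons_zero,
      List.getD_cons_succ, getD_replicate_one]
  · simp only [List.pairwise_cons, List.mem_cons, List.mem_replicate, List.pairwise_replicate]
    grind

lemma fkOp_row {n k : ℕ} (hk : k ≤ 1) (hn : 0 < n) : fkOp k {n + 2 ^ k} = {n} := by
  have he : 0 < 2 ^ k := by positivity
  obtain ⟨c, rfl⟩ : ∃ c, n = c + 1 := ⟨n - 1, by omega⟩
  refine fkOp_eq ?_ ?_ ?_
  · have h1 : ∀ i, row {c + 1} i = if i = 0 then c + 1 else 0 := fun i => by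
      simpa using row_hook c 0 i
    have h2 : ∀ i, row {c + 1 + 2 ^ k} i = if i = 0 then c + 1 + 2 ^ k else 0 := fun i => by
      have := row_hook (c + 2 ^ k) 0 i
      rw [show c + 2 ^ k + 1 = c + 1 + 2 ^ k by ring] at this
      simpa using this
    refine isHookRemoval_of_row (r := 0) (by simp) (by simp) he (by simp) (by simp) ?_ ?_
    · rw [h1, h2]; simp
    · intro i hi
      rw [h1, h2, if_neg hi, if_neg hi]
  · exact oddP_hook (b := 0).2 (by simp)
  · intro nu h _
    interval_cases k
    · obtain ⟨p, hp, rfl⟩ := IsHookRemoval.one h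
      rw [Multiset.mem_singleton] at hp
      subst hp
      simp [removeBox]
    · rcases IsHookRemoval.two h with ⟨p, hp, -, -, rfl⟩ | ⟨p, R, -, h, -⟩
      · rw [Multiset.mem_singleton] at hp
        subst hp
        simp
      · simpa using congrArg Multiset.card h

lemma fkOp_zero_column (n : ℕ) :
    fkOp 0 (Multiset.replicate (n + 1) 1) = Multiset.replicate n 1 := by
  have hpos : ∀ n, ∀ x ∈ Multiset.replicate n 1, 0 < x := fun n x hx => by
    rw [Multiset.eq_of_mem_replicate hx]; exact one_pos
  refine fkOp_eq ?_ ⟨hpos n, by simp [degSYT_column]⟩ ?_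
  · refine isHookRemoval_of_row (r := n) (hpos _) (hpos _) (by simp) (by simp) (by simp) ?_ ?_
    · rw [row_column, row_column]; simp
    · intro i hi
      rw [row_column, row_column]
      split_ifs <;> omega
  · intro nu h _
    obtain ⟨p, hp, rfl⟩ := IsHookRemoval.one h
    obtain rfl := Multiset.eq_of_mem_replicate hp
    rw [Multiset.replicate_succ, removeBox_cons, if_pos le_rfl]

lemma betaSet_column (n : ℕ) : betaSet (Multiset.replicate n 1) n = Finset.Icc 1 n := by
  ext y
  simp only [betaSet_eq, Finset.mem_image, Finset.mem_range, Finset.mem_Icc, row_column]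
  constructor
  · rintro ⟨i, hi, rfl⟩
    rw [if_pos hi]; omega
  · rintro ⟨h1, h2⟩
    exact ⟨n - y, by omega, by rw [if_pos (by omega)]; omega⟩

lemma isHookRemoval_two_column (n : ℕ) :
    IsHookRemoval 2 (Multiset.replicate (n + 2) 1) (Multiset.replicate n 1) := by
  have hpos : ∀ n, ∀ x ∈ Multiset.replicate n 1, 0 < x := fun n x hx => by
    rw [Multiset.eq_of_mem_replicate hx]; exact one_pos
  refine ⟨hpos _, hpos _, two_pos, n + 2, 2, by simp, by simp, ?_, le_rfl, ?_, ?_⟩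
  · rw [betaSet_column]; simp
  · rw [betaSet_column]; simp
  · rw [betaSet_column]
    ext y
    simp only [betaSet_eq, Finset.mem_image, Finset.mem_range, Finset.mem_insert,
      Finset.mem_erase, Finset.mem_Icc, row_column]
    constructor
    · rintro ⟨i, hi, rfl⟩
      split_ifs <;> omega
    · intro h
      by_cases hy : y ≤ 1
      · exact ⟨n + 1 - y, by omega, by rw [if_neg (by omega)]; omega⟩
      · exact ⟨n + 2 - y, by omega, by rw [if_pos (by omega)]; omega⟩

lemma fkOp_one_column (n : ℕ) :
    fkOp 1 (Multiset.replicate (n + 2) 1) = Multiset.replicate n 1 := by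
  refine fkOp_eq (isHookRemoval_two_column n) ⟨fun x hx => ?_, by simp [degSYT_column]⟩ ?_
  · rw [Multiset.eq_of_mem_replicate hx]; exact one_pos
  · intro nu h _
    rcases IsHookRemoval.two h with ⟨p, hp, hp2, -, -⟩ | ⟨p, R, -, hR, rfl⟩
    · have := Multiset.eq_of_mem_replicate hp
      omega
    · have hp : p ∈ Multiset.replicate (n + 2) 1 := by rw [hR]; simp
      obtain rfl := Multiset.eq_of_mem_replicate hp
      rw [Multiset.replicate_succ, Multiset.replicate_succ, Multiset.cons_inj_right,
        Multiset.cons_inj_right] at hR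
      subst hR
      simp only [Nat.sub_self, Multiset.filter_cons, lt_irrefl, if_false, zero_add]
      exact Multiset.filter_eq_self.2 fun x hx => by simp [Multiset.eq_of_mem_replicate hx]

lemma pos_of_mem_near_hook {a k x : ℕ}
    (hx : x ∈ (a + 2) ::ₘ 2 ::ₘ Multiset.replicate k 1) : 0 < x := by
  simp only [Multiset.mem_cons, Multiset.mem_replicate] at hx
  omega

lemma fkOp_zero_near_hook {a k t : ℕ} (h : a + k + 3 = 2 ^ t) :
    fkOp 0 ((a + 2) ::ₘ 2 ::ₘ Multiset.replicate k 1) =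
      (a + 2) ::ₘ Multiset.replicate (k + 1) 1 := by
  refine fkOp_eq ?_ ?_ ?_
  · refine isHookRemoval_of_row (r := 1) (fun x => pos_of_mem_near_hook)
      (fun x => pos_of_mem_hook) (by simp) (by simp) (by simp) ?_ ?_
    · rw [row_near_hook, row_hook]; simp
    · intro i hi
      rw [row_near_hook, row_hook]
      split_ifs <;> omega
  · exact oddP_hook.2 (odd_choose_of_add_one_eq (t := t) (by omega) (by omega))
  · intro nu hnu ho
    obtain ⟨p, hp, rfl⟩ := IsHookRemoval.one hnu
    have hsum : (removeBox ((a + 2) ::ₘ 2 ::ₘ Multiset.replicate k 1) p).sum = 2 ^ t := by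
      have hsum := congrArg Multiset.sum (Multiset.cons_erase hp)
      simp only [Multiset.sum_cons, Multiset.sum_replicate, smul_eq_mul, mul_one] at hsum
      have := pos_of_mem_near_hook hp
      unfold removeBox
      split_ifs
      · omega
      · rw [Multiset.sum_cons]; omega
    have hc := card_filter_one_lt_of_oddP ho hsum
    simp only [Multiset.mem_cons, Multiset.mem_replicate] at hp
    by_cases hp2 : p = 2
    · subst hp2
      rw [Multiset.cons_swap, removeBox_cons, if_neg (by omega), Multiset.replicate_succ,
        Multiset.cons_swap]
    rcases hp with rfl | rfl | ⟨hk, rfl⟩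
    · rw [removeBox_cons, if_neg (by omega), Multiset.filter_cons_of_pos _ (by omega),
        Multiset.filter_cons_of_pos _ (by omega)] at hc
      simp at hc
    · exact absurd rfl hp2
    · obtain ⟨k, rfl⟩ := Nat.exists_eq_succ_of_ne_zero hk
      rw [Multiset.replicate_succ, Multiset.cons_swap 2 1, Multiset.cons_swap _ 1, removeBox_cons,
        if_pos le_rfl, Multiset.filter_cons_of_pos _ (by omega),
        Multiset.filter_cons_of_pos _ (by omega)] at hc
      simp at hc

lemma fkOp_zero_hook {a b t : ℕ} (h : a + b + 3 = 2 ^ t) :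
    fkOp 0 ((a + 2) ::ₘ Multiset.replicate (b + 1) 1) =
      if Even b then (a + 2) ::ₘ Multiset.replicate b 1
      else (a + 1) ::ₘ Multiset.replicate (b + 1) 1 := by
  have harm : OddP ((a + 1) ::ₘ Multiset.replicate (b + 1) 1) ↔ ¬ Even b := by
    rw [oddP_hook, odd_choose_iff_of_add_two_eq (t := t) (by omega) (by omega), Nat.even_add_one]
  have hleg : OddP ((a + 2) ::ₘ Multiset.replicate b 1) ↔ Even b := by
    rw [oddP_hook, odd_choose_iff_of_add_two_eq (t := t) (by omega) (by omega)]
  have hcases : ∀ nu, IsHookRemoval (2 ^ 0) ((a + 2) ::ₘ Multiset.replicate (b + 1) 1) nu →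
      nu = (a + 2) ::ₘ Multiset.replicate b 1 ∨
        nu = (a + 1) ::ₘ Multiset.replicate (b + 1) 1 := by
    intro nu hnu
    obtain ⟨p, hp, rfl⟩ := IsHookRemoval.one hnu
    rcases Multiset.mem_cons.1 hp with rfl | hp
    · right
      rw [removeBox_cons, if_neg (by omega)]
      rfl
    · left
      obtain rfl := Multiset.eq_of_mem_replicate hp
      rw [Multiset.replicate_succ, Multiset.cons_swap, removeBox_cons, if_pos le_rfl]
  split_ifs with hb
  · refine fkOp_eq ?_ (hleg.2 hb) fun nu hnu ho => (hcases nu hnu).resolve_right ?_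
    · refine isHookRemoval_of_row (r := b + 1) (fun x => pos_of_mem_hook)
        (fun x => pos_of_mem_hook) (by simp) (by simp) (by simp) ?_ ?_
      · rw [row_hook, row_hook]; simp
      · intro i hi
        rw [row_hook, row_hook]
        split_ifs <;> omega
    · rintro rfl
      exact harm.1 ho hb
  · refine fkOp_eq ?_ (harm.2 hb) fun nu hnu ho => (hcases nu hnu).resolve_left ?_
    · refine isHookRemoval_of_row (r := 0) (fun x => pos_of_mem_hook)
        (fun x => pos_of_mem_hook) (by simp) (by simp) (by simp) ?_ ?_
      · rw [row_hook, row_hook]; simp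
      · intro i hi
        rw [row_hook, row_hook, if_neg hi, if_neg hi]
    · rintro rfl
      exact hb (hleg.1 ho)

lemma even_of_two_mul_eq {d m : ℕ} (h : 2 * d = (4 * m + 3) * (4 * m)) : Even d :=
  ⟨(4 * m + 3) * m, by linarith [show (4 * m + 3) * (4 * m) = 4 * ((4 * m + 3) * m) by ring]⟩

lemma odd_of_two_mul_eq {d m : ℕ} (h : 2 * d = (4 * m + 5) * (4 * m + 2)) : Odd d :=
  ⟨4 * m * m + 7 * m + 2, by nlinarith⟩

lemma fkOp_one_two_rows {m : ℕ} : fkOp 1 ((4 * m + 3) ::ₘ 2 ::ₘ 0) = {4 * m + 3} := by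
  refine fkOp_eq ?_ (oddP_hook (b := 0).2 (by simp)) ?_
  · have h1 : ∀ i, row {4 * m + 3} i = if i = 0 then 4 * m + 3 else 0 := fun i => by
      simpa using row_hook (4 * m + 2) 0 i
    have h2 := row_near_hook (4 * m + 1) 0
    simp only [Multiset.replicate_zero] at h2
    refine isHookRemoval_of_row (r := 1) (by simp) (by simp) (by simp) (by simp) (by simp) ?_ ?_
    · rw [h1, h2]; simp
    · intro i hi
      rw [h1, h2]
      split_ifs <;> omega
  · intro nu hnu ho
    rcases IsHookRemoval.two hnu with ⟨p, hp, hp2, hp1, rfl⟩ | ⟨p, R, -, h, -⟩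
    · simp only [Multiset.mem_cons, Multiset.notMem_zero, or_false] at hp hp1
      rcases hp with rfl | rfl
      · exfalso
        obtain ⟨n, rfl⟩ : ∃ n, m = n + 1 := ⟨m - 1, by omega⟩
        refine Nat.not_even_iff_odd.2 ho.2 (even_of_two_mul_eq (m := n + 1) ?_)
        rw [Multiset.erase_cons_head, Multiset.filter_cons_of_pos _ (by omega),
          Multiset.filter_cons_of_pos _ (by omega), Multiset.filter_zero,
          show 4 * (n + 1) + 3 - 2 = 4 * n + 3 + 2 by omega, two_mul_degSYT_two_rows]
        ring
      · rw [Multiset.cons_swap, Multiset.erase_cons_head, Multiset.filter_cons_of_neg _ (by omega),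
          Multiset.filter_cons_of_pos _ (by omega)]
        rfl
    · have hp : 4 * m + 3 ∈ p ::ₘ p ::ₘ R := by rw [← h]; simp
      have hp2 : 2 ∈ p ::ₘ p ::ₘ R := by rw [← h]; simp
      have hR : R = 0 := by
        have := congrArg Multiset.card h
        simpa using this
      simp only [hR, Multiset.mem_cons, Multiset.notMem_zero, or_false, or_self] at hp hp2
      omega

lemma fkOp_one_two_columns {m : ℕ} :
    fkOp 1 (2 ::ₘ 2 ::ₘ Multiset.replicate (4 * m + 1) 1) = Multiset.replicate (4 * m + 3) 1 := by
  have hpos : ∀ n, ∀ x ∈ Multiset.replicate n 1, 0 < x := fun n x hx => by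
    rw [Multiset.eq_of_mem_replicate hx]; exact one_pos
  refine fkOp_eq ?_ ⟨hpos _, by rw [degSYT_column]; exact odd_one⟩ ?_
  · refine ⟨fun x => pos_of_mem_near_hook (a := 0), hpos _, by simp, 4 * m + 3, 4 * m + 4,
      by simp, by simp, ?_, by omega, ?_, ?_⟩
    · rw [betaSet_eq]
      exact Finset.mem_image.2 ⟨0, by simp, by simp only [row_near_hook 0]; simp; omega⟩
    · simp only [betaSet_eq, Finset.mem_image, Finset.mem_range, row_near_hook 0]
      rintro ⟨i, hi, h⟩
      split_ifs at h <;> omega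
    · rw [betaSet_column]
      ext y
      simp only [betaSet_eq, Finset.mem_image, Finset.mem_range, Finset.mem_insert,
        Finset.mem_erase, Finset.mem_Icc, row_near_hook 0]
      constructor
      · intro h
        by_cases h1 : y = 4 * m + 2
        · left; omega
        right
        refine ⟨by omega, ?_⟩
        by_cases h2 : y = 4 * m + 3
        · exact ⟨1, by omega, by simp; omega⟩
        · refine ⟨4 * m + 3 - y, by omega, ?_⟩
          rw [if_neg (by omega), if_neg (by omega), if_pos (by omega)]
          omega
      · rintro (h | ⟨hne, i, hi, h⟩)
        · omega
        · split_ifs at h <;> omega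
  · intro nu hnu ho
    rcases IsHookRemoval.two hnu with ⟨p, hp, hp2, hp1, -⟩ | ⟨p, R, -, h, rfl⟩
    · simp only [Multiset.mem_cons, Multiset.mem_replicate] at hp hp1
      omega
    · have hp : p ∈ 2 ::ₘ 2 ::ₘ Multiset.replicate (4 * m + 1) 1 := by rw [h]; simp
      simp only [Multiset.mem_cons, Multiset.mem_replicate] at hp
      obtain rfl | rfl : p = 2 ∨ p = 1 := by omega
      · rw [Multiset.cons_inj_right, Multiset.cons_inj_right] at h
        rw [← h, Multiset.filter_eq_self.2 (fun x hx => by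
          simp only [Multiset.mem_cons, Multiset.mem_replicate] at hx; omega)]
        simp [Multiset.replicate_succ]
      · exfalso
        have hm : m ≠ 0 := by
          rintro rfl
          have := congrArg (Multiset.count 1) h
          simp at this
        obtain ⟨n, rfl⟩ := Nat.exists_eq_succ_of_ne_zero hm
        have hR : R = 2 ::ₘ 2 ::ₘ Multiset.replicate (4 * n + 3) 1 := by
          rw [show 4 * n.succ + 1 = 4 * n + 3 + 1 + 1 by omega, Multiset.replicate_succ,
            Multiset.replicate_succ, Multiset.cons_swap 2 1, Multiset.cons_swap 2 1,
            Multiset.cons_inj_right, Multiset.cons_swap 2 1, Multiset.cons_swap 2 1,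
            Multiset.cons_inj_right] at h
          exact h.symm
        refine Nat.not_even_iff_odd.2 ho.2 (even_of_two_mul_eq (m := n + 1) ?_)
        rw [Multiset.filter_cons_of_neg _ (by omega), Multiset.filter_cons_of_neg _ (by omega), hR,
          Multiset.filter_eq_self.2 (fun x => pos_of_mem_near_hook (a := 0)),
          two_mul_degSYT_two_columns]
        ring

lemma not_isHookRemoval_two_hook {a k c d : ℕ} :
    ¬ IsHookRemoval 2 ((a + 3) ::ₘ 2 ::ₘ Multiset.replicate (k + 1) 1)
      ((c + 1) ::ₘ Multiset.replicate d 1) := by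
  intro h
  have hhook : ∀ x ∈ (c + 1) ::ₘ Multiset.replicate d 1, 1 < x → x = c + 1 := by
    intro x hx h1
    rcases Multiset.mem_cons.1 hx with rfl | hx
    · rfl
    · rw [Multiset.eq_of_mem_replicate hx] at h1
      omega
  have hcard : (((c + 1) ::ₘ Multiset.replicate d 1).filter (fun p => 1 < p)).card ≤ 1 := by
    rw [Multiset.filter_cons, Multiset.card_add,
      Multiset.filter_eq_nil.2 (fun x hx => by simp [Multiset.eq_of_mem_replicate hx])]
    split_ifs <;> simp
  rcases h.two with ⟨p, hp, hp2, hp1, he⟩ | ⟨p, R, hp0, h, he⟩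
  · simp only [Multiset.mem_cons, Multiset.mem_replicate] at hp hp1
    obtain rfl : p = a + 3 := by omega
    rw [he, Multiset.erase_cons_head, Multiset.filter_cons_of_pos _ (by omega),
      Multiset.filter_cons_of_pos _ (by omega), Multiset.filter_cons_of_pos _ (by omega),
      Multiset.filter_cons_of_pos _ (by omega)] at hcard
    simp at hcard
  · have hp : p ∈ (a + 3) ::ₘ 2 ::ₘ Multiset.replicate (k + 1) 1 := by rw [h]; simp
    have hcount : 2 ≤ Multiset.count p ((a + 3) ::ₘ 2 ::ₘ Multiset.replicate (k + 1) 1) := by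
      rw [h]; simp
    have hp1 : p = 1 := by
      simp only [Multiset.count_cons, Multiset.count_replicate] at hcount
      split_ifs at hcount <;> omega
    subst hp1
    have ha : a + 3 ∈ 1 ::ₘ 1 ::ₘ R := by rw [← h]; simp
    have h2 : 2 ∈ 1 ::ₘ 1 ::ₘ R := by rw [← h]; simp
    simp only [Multiset.mem_cons] at ha h2
    have e1 := hhook (a + 3) (by
      rw [he, Multiset.mem_filter]
      exact ⟨Multiset.mem_cons_of_mem (Multiset.mem_cons_of_mem (by
        rcases ha with h | h | h <;> omega)), by omega⟩) (by omega)
    have e2 := hhook 2 (by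
      rw [he, Multiset.mem_filter]
      exact ⟨Multiset.mem_cons_of_mem (Multiset.mem_cons_of_mem (by
        rcases h2 with h | h | h <;> omega)), by omega⟩) (by omega)
    omega

lemma conjP_column (n : ℕ) : conjP (Multiset.replicate (n + 1) 1) = {n + 1} := by
  have h0 : (Multiset.replicate (n + 1) 1).filter (fun p => 0 < p) =
      Multiset.replicate (n + 1) 1 :=
    Multiset.filter_eq_self.2 fun x hx => by simp [Multiset.eq_of_mem_replicate hx]
  have h1 : ∀ i, (Multiset.replicate (n + 1) 1).filter (fun p => i + 1 < p) = 0 := fun i =>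
    Multiset.filter_eq_nil.2 fun x hx => by simp [Multiset.eq_of_mem_replicate hx]
  rw [conjP, Multiset.sum_replicate, smul_eq_mul, mul_one, Finset.range_val, ← Multiset.coe_range,
    List.range_succ_eq_map, ← Multiset.cons_coe, Multiset.map_cons, h0, Multiset.card_replicate,
    Multiset.filter_cons_of_pos _ n.succ_pos, Multiset.filter_eq_nil.2, Multiset.cons_zero]
  intro x hx
  simp only [Multiset.map_coe, List.map_map, Multiset.mem_coe, List.mem_map,
    Function.comp_apply] at hx
  obtain ⟨i, -, rfl⟩ := hx
  simp [h1]

lemma conjP_near_hook (a k : ℕ) :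
    conjP ((a + 2) ::ₘ 2 ::ₘ Multiset.replicate k 1) =
      (k + 2) ::ₘ 2 ::ₘ Multiset.replicate a 1 := by
  have hf : ∀ i, (((a + 2) ::ₘ 2 ::ₘ Multiset.replicate k 1).filter (fun p => i < p)).card =
      if i = 0 then k + 2 else if i = 1 then 2 else if i < a + 2 then 1 else 0 := by
    intro i
    have hr : ((Multiset.replicate k 1).filter (fun p => i < p)).card =
        if i = 0 then k else 0 := by
      split_ifs with h
      · rw [Multiset.filter_eq_self.2 fun x hx => by
          rw [Multiset.eq_of_mem_replicate hx]; omega, Multiset.card_replicate]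
      · rw [Multiset.filter_eq_nil.2 fun x hx => by
          rw [Multiset.eq_of_mem_replicate hx]; omega, Multiset.card_zero]
    simp only [← Multiset.countP_eq_card_filter, Multiset.countP_cons] at hr ⊢
    rw [hr]
    split_ifs <;> omega
  have hs : ((a + 2) ::ₘ 2 ::ₘ Multiset.replicate k 1).sum = 2 + a + (k + 2) := by
    simp only [Multiset.sum_cons, Multiset.sum_replicate, smul_eq_mul, mul_one]
    omega
  have hm : (List.range (2 + a + (k + 2))).map (fun i =>
      if i = 0 then k + 2 else if i = 1 then 2 else if i < a + 2 then 1 else 0) =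
      (k + 2) :: 2 :: (List.replicate a 1 ++ List.replicate (k + 2) 0) := by
    apply List.ext_getElem
    · simp; omega
    · intro i h1 h2
      rcases i with _ | _ | i
      · simp
      · simp
      · simp only [List.getElem_map, List.getElem_range, List.getElem_cons_succ,
          List.getElem_append, List.length_replicate, List.getElem_replicate]
        rcases lt_or_ge i a with h | h
        · simp [h]
        · simp [h.not_gt]
  rw [conjP, hs, Finset.range_val, ← Multiset.coe_range]
  simp only [hf]
  rw [Multiset.map_coe, hm, ← Multiset.cons_coe, ← Multiset.cons_coe, ← Multiset.coe_add,
    Multiset.coe_replicate, Multiset.coe_replicate, Multiset.filter_cons_of_pos _ (by omega),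
    Multiset.filter_cons_of_pos _ (by omega), Multiset.filter_add,
    Multiset.filter_eq_self.2 fun x hx => by rw [Multiset.eq_of_mem_replicate hx]; omega,
    Multiset.filter_eq_nil.2 fun x hx => by rw [Multiset.eq_of_mem_replicate hx]; omega, add_zero]

lemma fkOp_zero_fkOp_zero_row (n : ℕ) :
    fkOp 0 (fkOp 0 {n + 3}) = fkOp 1 {n + 3} := by
  have h1 := fkOp_row (n := n + 2) (k := 0) zero_le_one (by omega)
  have h2 := fkOp_row (n := n + 1) (k := 0) zero_le_one (by omega)
  have h3 := fkOp_row (n := n + 1) (k := 1) le_rfl (by omega)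
  rw [pow_zero] at h1 h2
  rw [pow_one] at h3
  exact (congrArg _ h1).trans (h2.trans h3.symm)

lemma fkOp_zero_fkOp_zero_column (n : ℕ) :
    fkOp 0 (fkOp 0 (Multiset.replicate (n + 2) 1)) = fkOp 1 (Multiset.replicate (n + 2) 1) := by
  rw [fkOp_zero_column, fkOp_zero_column, fkOp_one_column]

lemma fkOp_zero_fkOp_zero_two_rows {m t : ℕ} (ht : 2 ^ t = 4 * m + 4) :
    fkOp 0 (fkOp 0 ((4 * m + 3) ::ₘ 2 ::ₘ 0)) = fkOp 1 ((4 * m + 3) ::ₘ 2 ::ₘ 0) := by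
  have h1 := fkOp_zero_near_hook (a := 4 * m + 1) (k := 0) (t := t) (by omega)
  have h2 := fkOp_zero_hook (a := 4 * m + 1) (b := 0) (t := t) (by omega)
  rw [if_pos Even.zero] at h2
  rw [fkOp_one_two_rows]
  exact (congrArg _ h1).trans h2

lemma fkOp_zero_fkOp_zero_two_columns {m t : ℕ} (ht : 2 ^ t = 4 * m + 4) :
    fkOp 0 (fkOp 0 (2 ::ₘ 2 ::ₘ Multiset.replicate (4 * m + 1) 1)) =
      fkOp 1 (2 ::ₘ 2 ::ₘ Multiset.replicate (4 * m + 1) 1) := by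
  have h1 := fkOp_zero_near_hook (a := 0) (k := 4 * m + 1) (t := t) (by omega)
  have h2 := fkOp_zero_hook (a := 0) (b := 4 * m + 1) (t := t) (by omega)
  rw [if_neg (by rw [Nat.not_even_iff]; omega)] at h2
  rw [fkOp_one_two_columns]
  exact (congrArg _ h1).trans (h2.trans (Multiset.replicate_succ ..).symm)

lemma fkOp_zero_fkOp_zero_near_hook_ne {a k t : ℕ} (ht : a + k + 5 = 2 ^ t) :
    fkOp 0 (fkOp 0 ((a + 3) ::ₘ 2 ::ₘ Multiset.replicate (k + 1) 1)) ≠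
      fkOp 1 ((a + 3) ::ₘ 2 ::ₘ Multiset.replicate (k + 1) 1) := by
  obtain ⟨c, d, hcd⟩ : ∃ c d, fkOp 0 (fkOp 0 ((a + 3) ::ₘ 2 ::ₘ Multiset.replicate (k + 1) 1)) =
      (c + 1) ::ₘ Multiset.replicate d 1 := by
    rw [fkOp_zero_near_hook (a := a + 1) (k := k + 1) (t := t) (by omega),
      fkOp_zero_hook (a := a + 1) (b := k + 1) (t := t) (by omega)]
    split_ifs
    exacts [⟨_, _, rfl⟩, ⟨_, _, rfl⟩]
  rw [hcd]
  intro h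
  rcases fkOp_spec 1 ((a + 3) ::ₘ 2 ::ₘ Multiset.replicate (k + 1) 1) with h0 | h0
  · exact Multiset.cons_ne_zero (h.trans h0)
  · rw [← h, pow_one] at h0
    exact not_isHookRemoval_two_hook h0

lemma oddP_row (n : ℕ) : OddP {n + 1} := oddP_hook (b := 0).2 (by simp)

lemma oddP_column (n : ℕ) : OddP (Multiset.replicate n 1) :=
  ⟨fun x hx => by rw [Multiset.eq_of_mem_replicate hx]; exact one_pos,
    by rw [degSYT_column]; exact odd_one⟩

lemma oddP_two_rows (m : ℕ) : OddP ((4 * m + 3) ::ₘ 2 ::ₘ 0) := by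
  refine ⟨fun x => pos_of_mem_near_hook (a := 4 * m + 1) (k := 0), ?_⟩
  refine odd_of_two_mul_eq (m := m) ?_
  rw [two_mul_degSYT_two_rows (4 * m + 1)]

lemma oddP_two_columns (m : ℕ) : OddP (2 ::ₘ 2 ::ₘ Multiset.replicate (4 * m + 1) 1) := by
  refine ⟨fun x => pos_of_mem_near_hook (a := 0), odd_of_two_mul_eq (m := m) ?_⟩
  rw [two_mul_degSYT_two_columns]

lemma fkOp_zero_fkOp_zero_eq_iff {m t : ℕ} (ht : 2 ^ t = 4 * m + 4) {lam : Multiset ℕ}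
    (h : OddP lam) (hs : lam.sum = 2 ^ t + 1) :
    fkOp 0 (fkOp 0 lam) = fkOp 1 lam ↔
      lam = {4 * m + 5} ∨ lam = (4 * m + 3) ::ₘ 2 ::ₘ 0 ∨
        lam = Multiset.replicate (4 * m + 5) 1 ∨
          lam = 2 ::ₘ 2 ::ₘ Multiset.replicate (4 * m + 1) 1 := by
  constructor
  · intro hf
    rcases eq_of_oddP_of_sum h hs with rfl | rfl | ⟨a, k, hak, rfl⟩
    · left; rw [ht]
    · right; right; left; rw [ht]
    · rcases k with _ | k
      · right; left
        rw [show a = 4 * m + 1 by omega]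
        rfl
      · rcases a with _ | a
        · right; right; right
          rw [show k + 1 = 4 * m + 1 by omega]
        · exact absurd hf (fkOp_zero_fkOp_zero_near_hook_ne (t := t) (by omega))
  · rintro (rfl | rfl | rfl | rfl)
    · exact fkOp_zero_fkOp_zero_row _
    · exact fkOp_zero_fkOp_zero_two_rows ht
    · exact fkOp_zero_fkOp_zero_column _
    · exact fkOp_zero_fkOp_zero_two_columns ht

lemma conjP_eq_row_iff {t : ℕ} {lam : Multiset ℕ} (h : OddP lam)
    (hs : lam.sum = 2 ^ t + 1) (ht : 1 < 2 ^ t) :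
    conjP lam = {2 ^ t + 1} ↔ lam = Multiset.replicate (2 ^ t + 1) 1 := by
  refine ⟨fun hc => ?_, fun hc => by rw [hc, conjP_column]⟩
  rcases eq_of_oddP_of_sum h hs with rfl | rfl | ⟨a, k, hak, rfl⟩
  · have h1 : 1 ∈ conjP {2 ^ t + 1} := by
      simp only [conjP, Multiset.mem_filter, Multiset.mem_map, Finset.mem_val, Finset.mem_range]
      exact ⟨⟨0, by simp, by simp [Multiset.filter_singleton]⟩, one_pos⟩
    rw [hc, Multiset.mem_singleton] at h1
    omega
  · rfl
  · rw [conjP_near_hook] at hc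
    simpa using congrArg Multiset.card hc

lemma conjP_eq_two_rows_iff {m t : ℕ} (ht : 2 ^ t = 4 * m + 4) {lam : Multiset ℕ} (h : OddP lam)
    (hs : lam.sum = 2 ^ t + 1) :
    conjP lam = (4 * m + 3) ::ₘ 2 ::ₘ 0 ↔
      lam = 2 ::ₘ 2 ::ₘ Multiset.replicate (4 * m + 1) 1 := by
  refine ⟨fun hc => ?_, fun hc => ?_⟩
  · rcases eq_of_oddP_of_sum h hs with rfl | rfl | ⟨a, k, hak, rfl⟩
    · have h1 : ∀ x ∈ conjP {2 ^ t + 1}, x ≤ 1 := by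
        intro x hx
        simp only [conjP, Multiset.mem_filter, Multiset.mem_map] at hx
        obtain ⟨⟨i, -, rfl⟩, -⟩ := hx
        exact (Multiset.card_le_card (Multiset.filter_le _ _)).trans_eq (Multiset.card_singleton _)
      have := h1 2 (by rw [hc]; simp)
      omega
    · rw [conjP_column] at hc
      simpa using congrArg Multiset.card hc
    · rw [conjP_near_hook] at hc
      obtain rfl : a = 0 := by simpa using congrArg Multiset.card hc
      rw [show k = 4 * m + 1 by omega]
  · rw [hc]
    exact conjP_near_hook 0 (4 * m + 1)

lemma Gnum_zero_two_pow_add_one {m t : ℕ} (ht : 2 ^ t = 4 * m + 4) :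
    Gnum 0 (2 ^ t + 1) = 4 := by
  have hset : {lam : Multiset ℕ | OddP lam ∧ lam.sum = 2 ^ t + 1 ∧
      fkOp 0 (fkOp 0 lam) = fkOp (0 + 1) lam} =
      (({{4 * m + 5}, (4 * m + 3) ::ₘ 2 ::ₘ 0, Multiset.replicate (4 * m + 5) 1,
        2 ::ₘ 2 ::ₘ Multiset.replicate (4 * m + 1) 1} : Finset (Multiset ℕ)) :
          Set (Multiset ℕ)) := by
    ext lam
    simp only [Set.mem_ofPred_eq, Finset.coe_insert, Finset.coe_singleton, Set.mem_insert_iff,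
      Set.mem_singleton_iff]
    refine ⟨fun ⟨h, hs, hf⟩ => (fkOp_zero_fkOp_zero_eq_iff ht h hs).1 hf, fun hl => ?_⟩
    have ho : OddP lam := by
      rcases hl with rfl | rfl | rfl | rfl
      exacts [oddP_row _, oddP_two_rows _, oddP_column _, oddP_two_columns _]
    have hs : lam.sum = 2 ^ t + 1 := by
      rcases hl with rfl | rfl | rfl | rfl <;> simp <;> omega
    exact ⟨ho, hs, (fkOp_zero_fkOp_zero_eq_iff ht ho hs).2 hl⟩
  rw [Gnum, hset, Set.ncard_coe_finset, Finset.card_insert_of_notMem,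
    Finset.card_insert_of_notMem, Finset.card_insert_of_notMem, Finset.card_singleton]
  · rw [Finset.mem_singleton]
    intro h
    have := congrArg Multiset.card h
    simp at this
    omega
  · simp only [Finset.mem_insert, Finset.mem_singleton]
    rintro (h | h) <;> simpa using congrArg Multiset.card h
  · simp only [Finset.mem_insert, Finset.mem_singleton]
    rintro (h | h | h) <;> simpa using congrArg Multiset.card h

theorem stmt12 (t : ℕ) (ht : 2 ≤ t) :
    (∀ lam : Multiset ℕ, OddP lam → lam.sum = 2 ^ t + 1 →
      (fkOp 0 (fkOp 0 lam) = fkOp 1 lam ↔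
        (lam = {2 ^ t + 1} ∨ lam = {2 ^ t - 1, 2} ∨
          conjP lam = {2 ^ t + 1} ∨ conjP lam = {2 ^ t - 1, 2}))) ∧
    Gnum 0 (2 ^ t + 1) = 4 := by
  obtain ⟨m, hm⟩ : ∃ m, 2 ^ t = 4 * m + 4 := by
    obtain ⟨s, rfl⟩ := Nat.exists_eq_add_of_le ht
    refine ⟨2 ^ s - 1, ?_⟩
    have := Nat.one_le_two_pow (n := s)
    rw [pow_add]
    omega
  refine ⟨fun lam h hs => ?_, Gnum_zero_two_pow_add_one hm⟩
  have hpair : ({2 ^ t - 1, 2} : Multiset ℕ) = (4 * m + 3) ::ₘ 2 ::ₘ 0 := by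
    rw [hm]
    rfl
  rw [hpair, conjP_eq_row_iff h hs (by omega), conjP_eq_two_rows_iff hm h hs,
    fkOp_zero_fkOp_zero_eq_iff hm h hs, hm]

end OddSym
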